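/- Let J_1, …, J_m be words with 1 ≤ |J_a| ≤ N for each a, let u^1, …, u^m ∈ ℝ, and set u := ∑_{a=1}^m u^a e_{[J_a]} ∈ F. Then for every x ∈ ℝ^d the following identity of vectors in ℝ^d holds: ∑_{I word, 1 ≤ |I| ≤ N} π_I( ∑_{k=0}^N u^k / k! ) · (V_I Id)(x) = ∑_{k=1}^N (1/k!) ∑_{(a_1,…,a_k) ∈ {1,…,m}^k with |J_{a_1}| + ⋯ + |J_{a_k}| ≤ N} u^{a_1} ⋯ u^{a_k} · ( V_{[J_{a_1}]} V_{[J_{a_2}]} ⋯ V_{[J_{a_k}]} Id )(x), where V_{[J_{a_1}]} ⋯ V_{[J_{a_k}]} Id denotes the successive application (rightmost operator applied first) of the first-order differential operators V_{[J_{a_r}]} to the coordinate functions of ℝ^d. -/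

import Mathlib

noncomputable section

/-- The action of a vector field `W` on a function `f` on `ℝ^d`:
`(W f)(x) = Df(x)[W(x)]`. -/
def vfApply {d : ℕ} (W : (Fin d → ℝ) → (Fin d → ℝ)) (f : (Fin d → ℝ) → ℝ) :
    (Fin d → ℝ) → ℝ :=
  fun x => fderiv ℝ f x (W x)

/-- Successive application of a list of first-order differential operators
(vector fields), the rightmost operator being applied first:
`[W₁, …, W_k]` acts as `W₁ (W₂ (⋯ (W_k f)))`. -/
def vfListApply {d : ℕ} (Ws : List ((Fin d → ℝ) → (Fin d → ℝ)))
    (f : (Fin d → ℝ) → ℝ) : (Fin d → ℝ) → ℝ :=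
  Ws.foldr vfApply f

/-- `(W₁ ⋯ W_k Id)(x) ∈ ℝ^d`: the vector whose `ℓ`-th component is the operator
`W₁ ⋯ W_k` applied to the `ℓ`-th coordinate function, evaluated at `x`. -/
def vfListId {d : ℕ} (Ws : List ((Fin d → ℝ) → (Fin d → ℝ))) (x : Fin d → ℝ) :
    Fin d → ℝ :=
  fun ℓ => vfListApply Ws (fun y => y ℓ) x

/-- Auxiliary recursion for iterated Lie brackets of vector fields. -/
def bracketVFAux {n d : ℕ} (V : Fin n → ((Fin d → ℝ) → (Fin d → ℝ))) :
    ((Fin d → ℝ) → (Fin d → ℝ)) → List (Fin n) → ((Fin d → ℝ) → (Fin d → ℝ))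
  | W, [] => W
  | W, i :: rest => bracketVFAux V (VectorField.lieBracket ℝ W (V i)) rest

/-- The bracket vector field `V_{[I]}`:
`V_{[(i₁)]} = V_{i₁}` and `V_{[(i₁,…,i_k)]} = [V_{[(i₁,…,i_{k-1})]}, V_{i_k}]`. -/
def bracketVF {n d : ℕ} (V : Fin n → ((Fin d → ℝ) → (Fin d → ℝ))) :
    List (Fin n) → ((Fin d → ℝ) → (Fin d → ℝ))
  | [] => 0
  | i :: rest => bracketVFAux V (V i) rest

/-- Auxiliary recursion for the iterated bracket monomials `e_{[I]}` in the
free algebra. -/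
def lieWordAux {n : ℕ} (x : FreeAlgebra ℝ (Fin n)) :
    List (Fin n) → FreeAlgebra ℝ (Fin n)
  | [] => x
  | i :: rest =>
      lieWordAux (x * FreeAlgebra.ι ℝ i - FreeAlgebra.ι ℝ i * x) rest

/-- `e_{[I]}`: `e_{[(i₁)]} = X_{i₁}` and
`e_{[(i₁,…,i_k)]} = e_{[(i₁,…,i_{k-1})]} X_{i_k} - X_{i_k} e_{[(i₁,…,i_{k-1})]}`. -/
def lieWord {n : ℕ} : List (Fin n) → FreeAlgebra ℝ (Fin n)
  | [] => 0
  | i :: rest => lieWordAux (FreeAlgebra.ι ℝ i) rest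

/-- `π_I` : the coordinate functional at the word `I` with respect to the
monomial basis of the free algebra indexed by `FreeMonoid (Fin n)`. -/
def wordCoeff {n : ℕ} (I : List (Fin n)) (y : FreeAlgebra ℝ (Fin n)) : ℝ :=
  (FreeAlgebra.basisFreeMonoid ℝ (Fin n)).repr y (FreeMonoid.ofList I)

/-- The space of smooth real-valued functions on `ℝ^d`. -/
def smoothFunctions (d : ℕ) : Submodule ℝ ((Fin d → ℝ) → ℝ) where
  carrier := {f | ContDiff ℝ (⊤ : ℕ∞) f}
  add_mem' hf hg := by
    rw [Set.mem_ofPred_eq] at *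
    exact hf.add hg
  zero_mem' := by
    rw [Set.mem_ofPred_eq]
    exact contDiff_zero_fun
  smul_mem' c f hf := by
    rw [Set.mem_ofPred_eq] at *
    exact hf.const_smul c

theorem mem_smoothFunctions {d : ℕ} {f : (Fin d → ℝ) → ℝ} :
    f ∈ smoothFunctions d ↔ ContDiff ℝ (⊤ : ℕ∞) f := by
  rw [smoothFunctions, Submodule.mem_mk]
  exact Set.mem_ofPred

theorem contDiff_vfApply {d : ℕ} {W : (Fin d → ℝ) → (Fin d → ℝ)} {f : (Fin d → ℝ) → ℝ}
    (hW : ContDiff ℝ (⊤ : ℕ∞) W) (hf : ContDiff ℝ (⊤ : ℕ∞) f) :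
    ContDiff ℝ (⊤ : ℕ∞) (vfApply W f) :=
  (contDiff_infty_iff_fderiv.1 hf).2.clm_apply hW

theorem differentiable_smoothFunctions {d : ℕ} (f : smoothFunctions d) :
    Differentiable ℝ (f : (Fin d → ℝ) → ℝ) :=
  (contDiff_infty_iff_fderiv.1 (mem_smoothFunctions.1 f.2)).1

/-- A smooth vector field as a linear operator on smooth functions. -/
def vfEnd {d : ℕ} (W : (Fin d → ℝ) → (Fin d → ℝ)) (hW : ContDiff ℝ (⊤ : ℕ∞) W) :
    Module.End ℝ (smoothFunctions d) where
  toFun f := ⟨vfApply W f,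
    mem_smoothFunctions.2 (contDiff_vfApply hW (mem_smoothFunctions.1 f.2))⟩
  map_add' f g := by
    ext x
    simp [vfApply, fderiv_add (differentiable_smoothFunctions f x)
      (differentiable_smoothFunctions g x)]
  map_smul' c f := by
    ext x
    simp [vfApply, fderiv_const_smul (differentiable_smoothFunctions f x)]

theorem contDiff_lieBracket {d : ℕ} {V W : (Fin d → ℝ) → (Fin d → ℝ)}
    (hV : ContDiff ℝ (⊤ : ℕ∞) V) (hW : ContDiff ℝ (⊤ : ℕ∞) W) :
    ContDiff ℝ (⊤ : ℕ∞) (VectorField.lieBracket ℝ V W) :=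
  hV.lieBracket_vectorField hW (by simp)

theorem vfEnd_lieBracket {d : ℕ} {V W : (Fin d → ℝ) → (Fin d → ℝ)}
    (hV : ContDiff ℝ (⊤ : ℕ∞) V) (hW : ContDiff ℝ (⊤ : ℕ∞) W) :
    vfEnd (VectorField.lieBracket ℝ V W) (contDiff_lieBracket hV hW) =
      vfEnd V hV * vfEnd W hW - vfEnd W hW * vfEnd V hV := by
  ext f x
  have hf : ContDiff ℝ (⊤ : ℕ∞) (f : (Fin d → ℝ) → ℝ) := mem_smoothFunctions.1 f.2
  exact VectorField.fderiv_apply_lieBracket (n := (⊤ : ℕ∞)) hf.contDiffAt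
    (by rw [minSmoothness_of_isRCLikeNormedField]; exact WithTop.coe_le_coe.2 le_top)
    (hW.differentiable (by simp) x) (hV.differentiable (by simp) x)

theorem contDiff_bracketVFAux {n d : ℕ} {V : Fin n → ((Fin d → ℝ) → (Fin d → ℝ))}
    (hV : ∀ i, ContDiff ℝ (⊤ : ℕ∞) (V i)) (I : List (Fin n)) :
    ∀ {W : (Fin d → ℝ) → (Fin d → ℝ)}, ContDiff ℝ (⊤ : ℕ∞) W →
      ContDiff ℝ (⊤ : ℕ∞) (bracketVFAux V W I) := by
  induction I with
  | nil => exact fun hW => hW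
  | cons i I ih => exact fun hW => ih (contDiff_lieBracket hW (hV i))

theorem contDiff_bracketVF {n d : ℕ} {V : Fin n → ((Fin d → ℝ) → (Fin d → ℝ))}
    (hV : ∀ i, ContDiff ℝ (⊤ : ℕ∞) (V i)) (I : List (Fin n)) :
    ContDiff ℝ (⊤ : ℕ∞) (bracketVF V I) := by
  cases I with
  | nil => exact contDiff_const
  | cons i I => exact contDiff_bracketVFAux hV I (hV i)

/-- The representation of the free algebra by differential operators, `X_i ↦ V_i`. -/
def vfRep {n d : ℕ} (V : Fin n → ((Fin d → ℝ) → (Fin d → ℝ)))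
    (hV : ∀ i, ContDiff ℝ (⊤ : ℕ∞) (V i)) :
    FreeAlgebra ℝ (Fin n) →ₐ[ℝ] Module.End ℝ (smoothFunctions d) :=
  FreeAlgebra.lift ℝ fun i => vfEnd (V i) (hV i)

theorem vfRep_lieWordAux {n d : ℕ} {V : Fin n → ((Fin d → ℝ) → (Fin d → ℝ))}
    (hV : ∀ i, ContDiff ℝ (⊤ : ℕ∞) (V i)) (I : List (Fin n)) :
    ∀ {y : FreeAlgebra ℝ (Fin n)} {W : (Fin d → ℝ) → (Fin d → ℝ)}
      (hW : ContDiff ℝ (⊤ : ℕ∞) W), vfRep V hV y = vfEnd W hW →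
      vfRep V hV (lieWordAux y I) =
        vfEnd (bracketVFAux V W I) (contDiff_bracketVFAux hV I hW) := by
  induction I with
  | nil => exact fun _ h => h
  | cons i I ih =>
    intro y W hW h
    refine ih (contDiff_lieBracket hW (hV i)) ?_
    rw [vfEnd_lieBracket hW (hV i), map_sub, map_mul, map_mul, h]
    simp [vfRep]

theorem vfRep_lieWord {n d : ℕ} {V : Fin n → ((Fin d → ℝ) → (Fin d → ℝ))}
    (hV : ∀ i, ContDiff ℝ (⊤ : ℕ∞) (V i)) (I : List (Fin n)) :
    vfRep V hV (lieWord I) = vfEnd (bracketVF V I) (contDiff_bracketVF hV I) := by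
  cases I with
  | nil =>
    ext f x
    simp [lieWord, bracketVF, vfEnd, vfApply]
  | cons i I => exact vfRep_lieWordAux hV I (hV i) (by simp [vfRep])

/-- Products of smooth vector fields, as operators, evaluate to `vfListApply`. -/
theorem coe_prod_vfEnd_apply {d : ℕ} {α : Type*} (W : α → ((Fin d → ℝ) → (Fin d → ℝ)))
    (hW : ∀ a, ContDiff ℝ (⊤ : ℕ∞) (W a)) (l : List α) (f : smoothFunctions d) :
    (((l.map fun a => vfEnd (W a) (hW a)).prod f : smoothFunctions d) : (Fin d → ℝ) → ℝ) =
      vfListApply (l.map W) f := by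
  induction l with
  | nil => simp [vfListApply]
  | cons a l ih =>
    rw [List.map_cons, List.prod_cons, Module.End.mul_apply]
    change vfApply (W a) _ = vfApply (W a) (vfListApply (l.map W) f)
    rw [ih]

/-- Evaluation of an operator on the coordinate functions at a point. -/
def evalId {d : ℕ} (x : Fin d → ℝ) : Module.End ℝ (smoothFunctions d) →ₗ[ℝ] (Fin d → ℝ) where
  toFun T ℓ := (T ⟨fun y => y ℓ, mem_smoothFunctions.2 (contDiff_apply ℝ ℝ ℓ)⟩ : (Fin d → ℝ) → ℝ) x
  map_add' _ _ := rfl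
  map_smul' _ _ := rfl

theorem evalId_prod_vfEnd {d : ℕ} {α : Type*} (W : α → ((Fin d → ℝ) → (Fin d → ℝ)))
    (hW : ∀ a, ContDiff ℝ (⊤ : ℕ∞) (W a)) (l : List α) (x : Fin d → ℝ) :
    evalId x (l.map fun a => vfEnd (W a) (hW a)).prod = vfListId (l.map W) x := by
  ext ℓ
  exact congrFun (coe_prod_vfEnd_apply W hW l _) x

/-- The homogeneous elements of degree `k` of the free algebra. -/
def homogeneousPart (n k : ℕ) : Submodule ℝ (FreeAlgebra ℝ (Fin n)) :=
  Submodule.span ℝ (Set.range (FreeAlgebra.ι ℝ)) ^ k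

theorem ι_mem_homogeneousPart {n : ℕ} (i : Fin n) :
    FreeAlgebra.ι ℝ i ∈ homogeneousPart n 1 := by
  rw [homogeneousPart, pow_one]
  exact Submodule.subset_span ⟨i, rfl⟩

theorem mul_mem_homogeneousPart {n j k : ℕ} {y z : FreeAlgebra ℝ (Fin n)}
    (hy : y ∈ homogeneousPart n j) (hz : z ∈ homogeneousPart n k) :
    y * z ∈ homogeneousPart n (j + k) := by
  rw [homogeneousPart, pow_add]
  exact Submodule.mul_mem_mul hy hz

theorem lieWordAux_mem_homogeneousPart {n : ℕ} (I : List (Fin n)) :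
    ∀ {k : ℕ} {y : FreeAlgebra ℝ (Fin n)}, y ∈ homogeneousPart n k →
      lieWordAux y I ∈ homogeneousPart n (k + I.length) := by
  induction I with
  | nil => exact fun hy => hy
  | cons i I ih =>
    intro k y hy
    rw [List.length_cons, add_comm I.length, ← add_assoc]
    refine ih (sub_mem (mul_mem_homogeneousPart hy (ι_mem_homogeneousPart i)) ?_)
    rw [add_comm]
    exact mul_mem_homogeneousPart (ι_mem_homogeneousPart i) hy

theorem lieWord_mem_homogeneousPart {n : ℕ} (I : List (Fin n)) :
    lieWord I ∈ homogeneousPart n I.length := by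
  cases I with
  | nil => exact zero_mem _
  | cons i I =>
    rw [List.length_cons, add_comm]
    exact lieWordAux_mem_homogeneousPart I (ι_mem_homogeneousPart i)

theorem prod_mem_homogeneousPart {n : ℕ} {α : Type*} (y : α → FreeAlgebra ℝ (Fin n))
    (deg : α → ℕ) (hy : ∀ a, y a ∈ homogeneousPart n (deg a)) (l : List α) :
    (l.map y).prod ∈ homogeneousPart n (l.map deg).sum := by
  induction l with
  | nil => simp [homogeneousPart]
  | cons a l ih => simpa using mul_mem_homogeneousPart (hy a) ih

theorem basisFreeMonoid_ofList {n : ℕ} (I : List (Fin n)) :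
    FreeAlgebra.basisFreeMonoid ℝ (Fin n) (FreeMonoid.ofList I) =
      (I.map (FreeAlgebra.ι ℝ)).prod := by
  simp [FreeAlgebra.basisFreeMonoid, FreeAlgebra.equivMonoidAlgebraFreeMonoid,
    FreeMonoid.lift_apply]

theorem wordCoeff_prod_ι {n : ℕ} (I K : List (Fin n)) :
    wordCoeff I (K.map (FreeAlgebra.ι ℝ)).prod = if K = I then 1 else 0 := by
  classical
  rw [wordCoeff, ← basisFreeMonoid_ofList, Module.Basis.repr_self, Finsupp.single_apply]
  simp

/-- The part of `y` carried by words of length between `1` and `N`. -/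
def truncate {n : ℕ} (N : ℕ) : FreeAlgebra ℝ (Fin n) →ₗ[ℝ] FreeAlgebra ℝ (Fin n) where
  toFun y := ∑ k ∈ Finset.Icc 1 N, ∑ f : Fin k → Fin n,
    wordCoeff (List.ofFn f) y • ((List.ofFn f).map (FreeAlgebra.ι ℝ)).prod
  map_add' y z := by simp [wordCoeff, add_smul, Finset.sum_add_distrib]
  map_smul' c y := by simp [wordCoeff, mul_smul, Finset.smul_sum]

theorem truncate_of_mem_homogeneousPart {n N k : ℕ} {y : FreeAlgebra ℝ (Fin n)}
    (hy : y ∈ homogeneousPart n k) :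
    truncate N y = if k ∈ Finset.Icc 1 N then y else 0 := by
  rw [homogeneousPart, Submodule.span_pow] at hy
  induction hy using Submodule.span_induction with
  | mem y hy =>
    obtain ⟨g, rfl⟩ := Set.mem_pow.1 hy
    choose f hf using fun i => (g i).2
    have hg : (List.ofFn fun i => (g i : FreeAlgebra ℝ (Fin n))) =
        (List.ofFn f).map (FreeAlgebra.ι ℝ) := by
      simp [List.map_ofFn, Function.comp_def, hf]
    rw [hg]
    have inner (j : ℕ) : (∑ f' : Fin j → Fin n,
        wordCoeff (List.ofFn f') ((List.ofFn f).map (FreeAlgebra.ι ℝ)).prod •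
          ((List.ofFn f').map (FreeAlgebra.ι ℝ)).prod) =
        if k = j then ((List.ofFn f).map (FreeAlgebra.ι ℝ)).prod else 0 := by
      split_ifs with h
      · subst h
        simp [-List.map_ofFn, wordCoeff_prod_ι, List.ofFn_injective.eq_iff]
      · refine Finset.sum_eq_zero fun f' _ => ?_
        rw [wordCoeff_prod_ι, if_neg, zero_smul]
        intro h'
        exact h (by simpa using congrArg List.length h')
    change (∑ j ∈ Finset.Icc 1 N, _) = _
    simp only [inner, Finset.sum_ite_eq]
  | zero => simp
  | add y z _ _ hy hz => rw [map_add, hy, hz]; split_ifs <;> simp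
  | smul c y _ hy => rw [map_smul, hy]; split_ifs <;> simp

/-- Noncommutative expansion of a power of a linear combination. -/
theorem sum_smul_pow {A ι : Type*} [Ring A] [Algebra ℝ A] [Fintype ι] (u : ι → ℝ) (y : ι → A)
    (k : ℕ) :
    (∑ a, u a • y a) ^ k =
      ∑ t : Fin k → ι, (∏ r, u (t r)) • ((List.ofFn t).map y).prod := by
  induction k with
  | zero => simp
  | succ k ih =>
    rw [pow_succ', ih, ← (Fin.consEquiv fun _ => ι).sum_comp, Fintype.sum_prod_type,
      Finset.sum_mul_sum]
    simp [Fin.consEquiv, Fin.prod_univ_succ, List.ofFn_succ, smul_smul, mul_comm, Function.comp_def]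

/-- **Lemma 4.1.** With `u = ∑_a u^a e_{[J_a]}`, for every `x ∈ ℝ^d`:
`∑_{1 ≤ |I| ≤ N} π_I(∑_{k=0}^N u^k/k!) (V_I Id)(x)
  = ∑_{k=1}^N (1/k!) ∑_{|J_{a₁}|+⋯+|J_{a_k}| ≤ N} u^{a₁} ⋯ u^{a_k}
      (V_{[J_{a₁}]} ⋯ V_{[J_{a_k}]} Id)(x)`. -/
theorem bch_coefficient_identity
    (n d N m : ℕ) (hn : 1 ≤ n) (hd : 1 ≤ d) (hN : 1 ≤ N) (hm : 1 ≤ m)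
    (V : Fin n → ((Fin d → ℝ) → (Fin d → ℝ)))
    (hV : ∀ i, ContDiff ℝ (⊤ : ℕ∞) (V i))
    (J : Fin m → List (Fin n))
    (hJ : ∀ a, 1 ≤ (J a).length ∧ (J a).length ≤ N)
    (u : Fin m → ℝ) (x : Fin d → ℝ) :
    (∑ k ∈ Finset.Icc 1 N, ∑ f : Fin k → Fin n,
        wordCoeff (List.ofFn f)
            (∑ k' ∈ Finset.range (N + 1),
              ((k'.factorial : ℝ))⁻¹ • (∑ a, u a • lieWord (J a)) ^ k') •
          vfListId ((List.ofFn f).map V) x)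
      =
      ∑ k ∈ Finset.Icc 1 N, ((k.factorial : ℝ))⁻¹ •
        ∑ t ∈ Finset.univ.filter
            (fun t : Fin k → Fin m => (∑ r, (J (t r)).length) ≤ N),
          (∏ r, u (t r)) •
            vfListId ((List.ofFn t).map (fun a => bracketVF V (J a))) x := by
  set w : FreeAlgebra ℝ (Fin n) := ∑ a, u a • lieWord (J a) with hw
  let Ψ : FreeAlgebra ℝ (Fin n) →ₗ[ℝ] (Fin d → ℝ) :=
    evalId x ∘ₗ (vfRep V hV).toLinearMap
  have hΨ {α : Type} (y : α → FreeAlgebra ℝ (Fin n)) (W : α → ((Fin d → ℝ) → (Fin d → ℝ)))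
      (hW : ∀ a, ContDiff ℝ (⊤ : ℕ∞) (W a)) (hy : ∀ a, vfRep V hV (y a) = vfEnd (W a) (hW a))
      (l : List α) : Ψ (l.map y).prod = vfListId (l.map W) x := by
    change evalId x (vfRep V hV (l.map y).prod) = _
    rw [map_list_prod, List.map_map, ← evalId_prod_vfEnd W hW]
    simp only [Function.comp_def, hy]
  have hΨι := hΨ (FreeAlgebra.ι ℝ) V hV (fun i => by simp [vfRep])
  have hΨJ := hΨ (fun a => lieWord (J a)) (fun a => bracketVF V (J a))
    (fun a => contDiff_bracketVF hV (J a)) (fun a => vfRep_lieWord hV (J a))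
  have lhs (y : FreeAlgebra ℝ (Fin n)) : (∑ k ∈ Finset.Icc 1 N, ∑ f : Fin k → Fin n,
      wordCoeff (List.ofFn f) y • vfListId ((List.ofFn f).map V) x) = Ψ (truncate N y) := by
    simp [-List.map_ofFn, truncate, map_sum, hΨι]
  have hdeg (k : ℕ) (t : Fin k → Fin m) :
      ((List.ofFn t).map fun a => lieWord (J a)).prod ∈
        homogeneousPart n (∑ r, (J (t r)).length) := by
    have h := prod_mem_homogeneousPart (fun a => lieWord (J a)) (fun a => (J a).length)
      (fun a => lieWord_mem_homogeneousPart (J a)) (List.ofFn t)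
    rwa [List.map_ofFn, List.sum_ofFn] at h
  have hle (k : ℕ) (t : Fin k → Fin m) : k ≤ ∑ r, (J (t r)).length := by
    simpa using Finset.sum_le_sum fun r (_ : r ∈ Finset.univ) => (hJ (t r)).1
  have hpow (k : ℕ) (hk : 1 ≤ k) : Ψ (truncate N (w ^ k)) =
      ∑ t ∈ Finset.univ.filter (fun t : Fin k → Fin m => (∑ r, (J (t r)).length) ≤ N),
        (∏ r, u (t r)) • vfListId ((List.ofFn t).map fun a => bracketVF V (J a)) x := by
    rw [hw, sum_smul_pow, map_sum, map_sum, Finset.sum_filter]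
    refine Finset.sum_congr rfl fun t _ => ?_
    rw [map_smul, map_smul, truncate_of_mem_homogeneousPart (hdeg k t), ← hΨJ]
    simp only [Finset.mem_Icc, hk.trans (hle k t), true_and]
    split_ifs <;> simp
  have hone : truncate N (w ^ 0) = 0 := by
    rw [truncate_of_mem_homogeneousPart (k := 0)]
    · simp
    · simp [homogeneousPart]
  rw [lhs, map_sum, map_sum, Finset.range_eq_Ico, Finset.sum_eq_sum_Ico_succ_bot (by omega),
    map_smul, hone, smul_zero, map_zero, zero_add]
  refine Finset.sum_congr rfl fun k hk => ?_
  rw [map_smul, map_smul, hpow k (Finset.mem_Ico.1 hk).1]
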